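/- Let a, b be nonnegative integers with a + b = n ≥ 1, let 1 < σ ≤ 1.15, set σ1 = 1/2 + (1/2)·√(1+4σ²), let k ∈ {1,2,3,4}, and let γ0 > 1. Define, for complex s, G(s) = −(n/2)·log(π) + (a/2)·Re ψ(s/2) + (b/2)·Re ψ((s+1)/2), which equals the real part of the logarithmic derivative of γ_K(s) = π^{−b(s+1)/2} Γ((s+1)/2)^b · π^{−as/2} Γ(s/2)^a. Then G(σ + i·k·γ0) − κ·G(σ1 + i·k·γ0) ≤ ( ((1−κ)/2)·log(γ0) + ((1−κ)/2)·log(k/π) + D(k) )·n, where D(1) = 0.3918, D(2) = 0.3915, D(3) = 0.4062, D(4) = 0.4266. -/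

import Mathlib

namespace ZFR

noncomputable def kappa : ℝ := 1 / Real.sqrt 5

noncomputable def sigma1 (σ : ℝ) : ℝ := 1 / 2 + Real.sqrt (1 + 4 * σ ^ 2) / 2

/-- `ψ = Γ'/Γ`, the logarithmic derivative of the complex Gamma function. -/
noncomputable def psi (s : ℂ) : ℂ := logDeriv Complex.Gamma s

/-- `G(s)` is the real part of the logarithmic derivative of
`γ_K(s) = π^(-b(s+1)/2) Γ((s+1)/2)^b π^(-as/2) Γ(s/2)^a`, where `a + b = n`. -/
noncomputable def G (a b : ℕ) (s : ℂ) : ℝ :=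
  -(((a + b : ℕ) : ℝ) / 2) * Real.log Real.pi
    + ((a : ℝ) / 2) * (psi (s / 2)).re + ((b : ℝ) / 2) * (psi ((s + 1) / 2)).re

open Filter Topology

/-- If real functions `f n` converge to `h` on the right of `x` and their derivatives there are
bounded by `U + c n` with `c n → 0`, then the derivative of `h` at `x` is at most `U x`. -/
lemma hasDerivAt_le_of_tendsto_of_deriv_le {f f' : ℕ → ℝ → ℝ} {h U : ℝ → ℝ} {c : ℕ → ℝ} {x d : ℝ}
    (hf : ∀ n, 1 ≤ n → ∀ u ∈ Set.Icc x (x + 1), HasDerivAt (f n) (f' n u) u)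
    (hU : ContinuousAt U x)
    (hf' : ∀ n, 1 ≤ n → ∀ u ∈ Set.Icc x (x + 1), f' n u ≤ U u + c n)
    (hc : Tendsto c atTop (𝓝 0))
    (hlim : ∀ u ∈ Set.Icc x (x + 1), Tendsto (fun n => f n u) atTop (𝓝 (h u)))
    (hd : HasDerivAt h d x) : d ≤ U x := by
  refine le_of_forall_gt_imp_ge_of_dense fun M hM => ?_
  obtain ⟨δ, hδ, hδU⟩ := Metric.eventually_nhds_iff.1 (hU.eventually_lt_const hM)
  have key : ∀ v, x < v → v < x + min δ 1 → h v - h x ≤ M * (v - x) := by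
    intro v hv hv'
    have hv1 : v < x + δ := hv'.trans_le (by gcongr; exact min_le_left _ _)
    have hv2 : v < x + 1 := hv'.trans_le (by gcongr; exact min_le_right _ _)
    have hsub : Set.Icc x v ⊆ Set.Icc x (x + 1) := Set.Icc_subset_Icc_right hv2.le
    have h1 : Tendsto (fun n => f n v - f n x) atTop (𝓝 (h v - h x)) :=
      (hlim v ⟨hv.le, hv2.le⟩).sub (hlim x ⟨le_rfl, by linarith⟩)
    have h2 : Tendsto (fun n => (M + c n) * (v - x)) atTop (𝓝 ((M + 0) * (v - x))) :=
      (hc.const_add M).mul_const _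
    rw [add_zero] at h2
    refine le_of_tendsto_of_tendsto h1 h2 ?_
    filter_upwards [eventually_ge_atTop 1] with n hn
    refine (convex_Icc x v).image_sub_le_mul_sub_of_deriv_le
      (fun u hu => (hf n hn u (hsub hu)).continuousAt.continuousWithinAt)
      (fun u hu => (hf n hn u (hsub (interior_subset hu))).differentiableAt.differentiableWithinAt)
      (fun u hu => ?_) x ⟨le_rfl, hv.le⟩ v ⟨hv.le, le_rfl⟩ hv.le
    have hu' := interior_subset hu
    rw [(hf n hn u (hsub hu')).deriv]
    have := @hδU u (by rw [Real.dist_eq, abs_lt]; constructor <;> linarith [hu'.1, hu'.2])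
    linarith [hf' n hn u (hsub hu')]
  have hslope := (hasDerivAt_iff_tendsto_slope.1 hd).mono_left
    (nhdsWithin_mono x (fun v (hv : v ∈ Set.Ioi x) => (ne_of_gt hv : v ≠ x)))
  refine le_of_tendsto hslope ?_
  have : Set.Ioo x (x + min δ 1) ∈ 𝓝[>] x := Ioo_mem_nhdsGT (by simp [hδ])
  filter_upwards [this] with v hv
  rw [slope_def_field, div_le_iff₀ (by linarith [hv.1])]
  exact key v hv.1 hv.2

lemma hasDerivAt_log_norm {F : ℝ → ℂ} {F' : ℂ} {x : ℝ} (hF : HasDerivAt F F' x) (h0 : F x ≠ 0) :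
    HasDerivAt (fun u => Real.log ‖F u‖) (F' / F x).re x := by
  have hre : HasDerivAt (fun u => (F u).re) F'.re x :=
    (Complex.reCLM.hasFDerivAt.comp_hasDerivAt x hF)
  have him : HasDerivAt (fun u => (F u).im) F'.im x :=
    (Complex.imCLM.hasFDerivAt.comp_hasDerivAt x hF)
  have hq : Complex.normSq (F x) ≠ 0 := by simpa using h0
  have hsq := ((hre.mul hre).add (him.mul him)).log (by simpa [Complex.normSq_apply] using hq)
  have := hsq.const_mul (1 / 2 : ℝ)
  convert! this using 1
  · funext u
    have : (F u).re * (F u).re + (F u).im * (F u).im = ‖F u‖ ^ 2 := by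
      rw [Complex.sq_norm, Complex.normSq_apply]
    simp only [Pi.add_apply, Pi.mul_apply, this, Real.log_pow]
    push_cast; ring
  · rw [Complex.div_re]
    simp only [Pi.add_apply, Pi.mul_apply, Complex.normSq_apply] at hq ⊢
    field_simp
    ring

lemma hasDerivAt_log_norm_Gamma {x : ℝ} (hx : 0 < x) (y : ℝ) :
    HasDerivAt (fun u : ℝ => Real.log ‖Complex.Gamma (u + y * Complex.I)‖)
      (psi (x + y * Complex.I)).re x := by
  have hz : 0 < ((x : ℂ) + y * Complex.I).re := by simpa using hx
  have hd : DifferentiableAt ℂ Complex.Gamma ((x : ℂ) + y * Complex.I) := by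
    refine Complex.differentiableAt_Gamma _ fun m hm => ?_
    rw [hm] at hz
    have : (0 : ℝ) ≤ m := m.cast_nonneg
    simp at hz
    linarith
  have h1 : HasDerivAt (fun u : ℝ => Complex.Gamma (u + y * Complex.I))
      (deriv Complex.Gamma (x + y * Complex.I)) x := by
    have := (hd.hasDerivAt.comp_add_const (x : ℂ) (y * Complex.I)).comp_ofReal
    simpa using this
  exact hasDerivAt_log_norm h1 (Complex.Gamma_ne_zero_of_re_pos hz)

lemma log_norm_GammaSeq {x : ℝ} (hx : 0 < x) (y : ℝ) {n : ℕ} (hn : 1 ≤ n) :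
    Real.log ‖Complex.GammaSeq (x + y * Complex.I) n‖ =
      x * Real.log n + Real.log (n.factorial)
        - ∑ j ∈ Finset.range (n + 1), Real.log ((x + j) ^ 2 + y ^ 2) / 2 := by
  have hn0 : (0 : ℝ) < n := by exact_mod_cast hn
  have hnorm : ∀ j : ℕ, ‖(x : ℂ) + y * Complex.I + j‖ ^ 2 = (x + j) ^ 2 + y ^ 2 := by
    intro j
    rw [Complex.sq_norm, Complex.normSq_apply]
    simp
    ring
  have hpos : ∀ j : ℕ, (0 : ℝ) < (x + j) ^ 2 + y ^ 2 := fun j => by positivity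
  have hne : ∀ j : ℕ, ‖(x : ℂ) + y * Complex.I + j‖ ≠ 0 := fun j h => by
    have := hpos j
    rw [← hnorm j, h] at this
    simp at this
  rw [Complex.GammaSeq, norm_div, norm_mul, Complex.norm_natCast_cpow_of_pos (by omega), norm_prod,
    Complex.norm_natCast, Real.log_div (by positivity)
      (Finset.prod_ne_zero_iff.2 fun j _ => hne j),
    Real.log_mul (by positivity) (by positivity), Real.log_rpow hn0,
    Real.log_prod (fun j _ => hne j)]
  congr 1
  · simp
  · refine Finset.sum_congr rfl fun j _ => ?_
    rw [← hnorm j, Real.log_pow]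
    push_cast; ring

lemma tendsto_log_norm_GammaSeq {x : ℝ} (hx : 0 < x) (y : ℝ) :
    Tendsto (fun n => Real.log ‖Complex.GammaSeq (x + y * Complex.I) n‖) atTop
      (𝓝 (Real.log ‖Complex.Gamma (x + y * Complex.I)‖)) := by
  have hz : 0 < ((x : ℂ) + y * Complex.I).re := by simpa using hx
  exact (Complex.GammaSeq_tendsto_Gamma _).norm.log
    (norm_ne_zero_iff.2 (Complex.Gamma_ne_zero_of_re_pos hz))

lemma hasDerivAt_log_norm_GammaSeq {x : ℝ} (hx : 0 < x) (y : ℝ) {n : ℕ} (hn : 1 ≤ n) :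
    HasDerivAt (fun u : ℝ => Real.log ‖Complex.GammaSeq (u + y * Complex.I) n‖)
      (Real.log n - ∑ j ∈ Finset.range (n + 1), (x + j) / ((x + j) ^ 2 + y ^ 2)) x := by
  have h1 : HasDerivAt (fun u : ℝ => u * Real.log n + Real.log (n.factorial)
        - ∑ j ∈ Finset.range (n + 1), Real.log ((u + j) ^ 2 + y ^ 2) / 2)
      (Real.log n - ∑ j ∈ Finset.range (n + 1), (x + j) / ((x + j) ^ 2 + y ^ 2)) x := by
    refine HasDerivAt.sub ?_ (HasDerivAt.fun_sum fun j _ => ?_)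
    · simpa using ((hasDerivAt_id x).mul_const (Real.log n)).add_const (Real.log (n.factorial))
    · have hp : (x + j) ^ 2 + y ^ 2 ≠ 0 := by positivity
      have := (((((hasDerivAt_id x).add_const (j : ℝ)).pow 2).add_const (y ^ 2)).log
        (by simpa using hp)).div_const 2
      convert! this using 1
      simp
      field_simp
  refine h1.congr_of_eventuallyEq ?_
  filter_upwards [lt_mem_nhds hx] with u hu
  exact log_norm_GammaSeq hu y hn

lemma abs_half_log_diff_sub_le {u : ℝ} (hu : 1 / 2 < u) (y : ℝ) :
    |u / (u ^ 2 + y ^ 2)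
      - (Real.log ((u + 1) ^ 2 + y ^ 2) / 2 - Real.log (u ^ 2 + y ^ 2) / 2)|
      ≤ 1 / (2 * u - 1) - 1 / (2 * u + 1) := by
  have hu0 : 0 < u := by linarith
  have hq : 0 < u ^ 2 + y ^ 2 := by positivity
  have hq' : 0 < (u + 1) ^ 2 + y ^ 2 := by positivity
  have hm : 0 < 2 * u - 1 := by linarith
  have hp : 0 < 2 * u + 1 := by linarith
  have hlog : Real.log ((u + 1) ^ 2 + y ^ 2) - Real.log (u ^ 2 + y ^ 2)
      = Real.log (1 + (2 * u + 1) / (u ^ 2 + y ^ 2)) := by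
    rw [← Real.log_div hq'.ne' hq.ne']
    congr 1
    field_simp
    ring
  have hv : 0 < (2 * u + 1) / (u ^ 2 + y ^ 2) := by positivity
  have hup := Real.log_le_sub_one_of_pos (x := 1 + (2 * u + 1) / (u ^ 2 + y ^ 2)) (by linarith)
  have hlo := Real.le_log_one_add_of_nonneg hv.le
  rw [← hlog] at hup hlo
  have e1 : 1 / (2 * u - 1) - 1 / (2 * u + 1) = 2 / ((2 * u - 1) * (2 * u + 1)) := by
    field_simp; ring
  rw [e1, abs_le]
  constructor
  · have e2 : u / (u ^ 2 + y ^ 2) - (2 * u + 1) / (u ^ 2 + y ^ 2) / 2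
        = -(1 / (2 * (u ^ 2 + y ^ 2))) := by
      field_simp; ring
    have e3 : 1 / (2 * (u ^ 2 + y ^ 2)) ≤ 2 / ((2 * u - 1) * (2 * u + 1)) := by
      rw [div_le_div_iff₀ (by positivity) (by positivity)]
      nlinarith [sq_nonneg y]
    linarith
  · have e2 : u / (u ^ 2 + y ^ 2)
        - 2 * ((2 * u + 1) / (u ^ 2 + y ^ 2)) / ((2 * u + 1) / (u ^ 2 + y ^ 2) + 2) / 2
        = (u ^ 2 + u - y ^ 2) / ((u ^ 2 + y ^ 2) * (2 * (u ^ 2 + y ^ 2) + 2 * u + 1)) := by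
      field_simp
      ring
    have e3 : (u ^ 2 + u - y ^ 2) / ((u ^ 2 + y ^ 2) * (2 * (u ^ 2 + y ^ 2) + 2 * u + 1))
        ≤ 2 / ((2 * u - 1) * (2 * u + 1)) := by
      rw [div_le_div_iff₀ (by positivity) (by positivity)]
      have := mul_nonneg (sq_nonneg y) (sq_nonneg u)
      have := mul_nonneg (sq_nonneg y) hu0.le
      nlinarith [sq_nonneg y, sq_nonneg (y ^ 2), mul_pos hu0 hu0]
    linarith

lemma abs_sum_sub_half_log_le {w : ℝ} (hw : 1 / 2 < w) (y : ℝ) (n : ℕ) :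
    |∑ j ∈ Finset.range n, (w + j) / ((w + j) ^ 2 + y ^ 2)
      - (Real.log ((w + n) ^ 2 + y ^ 2) / 2 - Real.log (w ^ 2 + y ^ 2) / 2)|
      ≤ 1 / (2 * w - 1) - 1 / (2 * (w + n) - 1) := by
  induction n with
  | zero => simp
  | succ n ih =>
    have hn : (0 : ℝ) ≤ n := n.cast_nonneg
    have h := abs_half_log_diff_sub_le (u := w + n) (by linarith) y
    rw [Finset.sum_range_succ]
    push_cast
    rw [← add_assoc, show 2 * (w + n + 1) - 1 = 2 * (w + n) + 1 by ring]
    rw [abs_le] at ih h ⊢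
    constructor <;> linarith [ih.1, ih.2, h.1, h.2]

lemma abs_sum_range_succ_sub_le {x : ℝ} (hx : 0 < x) (y : ℝ) (n : ℕ) :
    |∑ j ∈ Finset.range (n + 1), (x + j) / ((x + j) ^ 2 + y ^ 2)
      - (x / (x ^ 2 + y ^ 2)
        + (Real.log ((x + 1 + n) ^ 2 + y ^ 2) / 2 - Real.log ((x + 1) ^ 2 + y ^ 2) / 2))|
      ≤ 1 / (2 * x + 1) := by
  have h := abs_sum_sub_half_log_le (w := x + 1) (by linarith) y n
  have hn : (0 : ℝ) ≤ n := n.cast_nonneg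
  have h0 : 0 ≤ 1 / (2 * (x + 1 + n) - 1) := one_div_nonneg.2 (by linarith)
  have e : ∀ j : ℕ, x + ((j + 1 : ℕ) : ℝ) = x + 1 + j := fun j => by push_cast; ring
  rw [Finset.sum_range_succ']
  simp only [e, Nat.cast_zero, add_zero]
  rw [show 2 * (x + 1) - 1 = 2 * x + 1 by ring] at h
  rw [abs_le] at h ⊢
  constructor <;> linarith [h.1, h.2]

lemma tendsto_half_log_sub_log (X y : ℝ) :
    Tendsto (fun n : ℕ => Real.log ((X + n) ^ 2 + y ^ 2) / 2 - Real.log n) atTop (𝓝 0) := by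
  have hX : Tendsto (fun n : ℕ => X / (n : ℝ)) atTop (𝓝 0) :=
    tendsto_const_div_atTop_nhds_zero_nat X
  have hy : Tendsto (fun n : ℕ => y / (n : ℝ)) atTop (𝓝 0) :=
    tendsto_const_div_atTop_nhds_zero_nat y
  have h1 : Tendsto (fun n : ℕ => (X / (n : ℝ) + 1) ^ 2 + (y / n) ^ 2) atTop (𝓝 1) := by
    simpa using ((hX.add_const 1).pow 2).add (hy.pow 2)
  have h2 := (h1.log one_ne_zero).div_const 2
  simp only [Real.log_one, zero_div] at h2
  refine h2.congr' ?_
  filter_upwards [eventually_ge_atTop 1, h1.eventually_const_lt zero_lt_one] with n hn hpos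
  have hn0 : (0 : ℝ) < n := by exact_mod_cast hn
  have e : (X + n) ^ 2 + y ^ 2 = ((X / (n : ℝ) + 1) ^ 2 + (y / n) ^ 2) * (n : ℝ) ^ 2 := by
    field_simp
  rw [e, Real.log_mul hpos.ne' (by positivity), Real.log_pow]
  push_cast; ring

lemma psi_re_le {x : ℝ} (hx : 0 < x) (y : ℝ) :
    (psi (x + y * Complex.I)).re ≤
      Real.log ((x + 1) ^ 2 + y ^ 2) / 2 + 1 / (2 * x + 1) - x / (x ^ 2 + y ^ 2) := by
  refine hasDerivAt_le_of_tendsto_of_deriv_le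
    (U := fun x => Real.log ((x + 1) ^ 2 + y ^ 2) / 2 + 1 / (2 * x + 1) - x / (x ^ 2 + y ^ 2))
    (c := fun _ => 0)
    (fun n hn u hu => hasDerivAt_log_norm_GammaSeq (hx.trans_le hu.1) y hn)
    ?_ (fun n hn u hu => ?_) tendsto_const_nhds
    (fun u hu => tendsto_log_norm_GammaSeq (hx.trans_le hu.1) y)
    (hasDerivAt_log_norm_Gamma hx y)
  · fun_prop (disch := positivity)
  · have hu0 : 0 < u := hx.trans_le hu.1
    have hn0 : (0 : ℝ) < n := by exact_mod_cast hn
    have h := abs_le.1 (abs_sum_range_succ_sub_le hu0 y n)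
    have hl : Real.log ((n : ℝ) ^ 2) ≤ Real.log ((u + 1 + n) ^ 2 + y ^ 2) :=
      Real.log_le_log (by positivity) (by nlinarith [sq_nonneg y])
    rw [Real.log_pow] at hl
    push_cast at hl
    linarith [h.1]

lemma le_psi_re {x : ℝ} (hx : 0 < x) (y : ℝ) :
    Real.log ((x + 1) ^ 2 + y ^ 2) / 2 - 1 / (2 * x + 1) - x / (x ^ 2 + y ^ 2) ≤
      (psi (x + y * Complex.I)).re := by
  have key : -(psi (x + y * Complex.I)).re ≤
      -(Real.log ((x + 1) ^ 2 + y ^ 2) / 2 - 1 / (2 * x + 1) - x / (x ^ 2 + y ^ 2)) := by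
    refine hasDerivAt_le_of_tendsto_of_deriv_le
      (U := fun x =>
        -(Real.log ((x + 1) ^ 2 + y ^ 2) / 2 - 1 / (2 * x + 1) - x / (x ^ 2 + y ^ 2)))
      (fun n hn u hu => (hasDerivAt_log_norm_GammaSeq (hx.trans_le hu.1) y hn).neg)
      ?_ (fun n hn u hu => ?_) (tendsto_half_log_sub_log (x + 2) y)
      (fun u hu => (tendsto_log_norm_GammaSeq (hx.trans_le hu.1) y).neg)
      (hasDerivAt_log_norm_Gamma hx y).neg
    · fun_prop (disch := positivity)
    · have hu0 : 0 < u := hx.trans_le hu.1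
      have h := abs_le.1 (abs_sum_range_succ_sub_le hu0 y n)
      have hn0 : (0 : ℝ) ≤ n := n.cast_nonneg
      have hl : Real.log ((u + 1 + n) ^ 2 + y ^ 2) ≤ Real.log ((x + 2 + n) ^ 2 + y ^ 2) := by
        refine Real.log_le_log (by positivity) ?_
        have := hu.2
        gcongr ?_ ^ 2 + _
        linarith
      linarith [h.2]
  linarith

lemma kappa_bounds : 0.447 ≤ kappa ∧ kappa ≤ 0.4473 := by
  have h5 : Real.sqrt 5 ^ 2 = 5 := Real.sq_sqrt (by norm_num)
  have hp : 0 < Real.sqrt 5 := by positivity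
  unfold kappa
  constructor
  · rw [le_div_iff₀ hp]; nlinarith
  · rw [div_le_iff₀ hp]; nlinarith

lemma sigma1_bounds {σ : ℝ} (hσ : 1 < σ) : 1.6 ≤ sigma1 σ ∧ σ ≤ sigma1 σ ∧ sigma1 σ ≤ σ + 0.62 := by
  have hs : Real.sqrt (1 + 4 * σ ^ 2) ^ 2 = 1 + 4 * σ ^ 2 := Real.sq_sqrt (by positivity)
  have hp : 0 ≤ Real.sqrt (1 + 4 * σ ^ 2) := by positivity
  unfold sigma1
  refine ⟨?_, ?_, ?_⟩ <;> nlinarith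

lemma psi_re_sub_kappa_mul_le {x₀ x₁ t : ℝ} (h0 : 1 / 2 ≤ x₀) (h01 : x₀ ≤ x₁)
    (h10 : x₁ ≤ x₀ + 0.31) (ht : 1 ≤ t) :
    (psi (x₀ + (t / 2 : ℝ) * Complex.I)).re - kappa * (psi (x₁ + (t / 2 : ℝ) * Complex.I)).re ≤
      (1 - kappa) * Real.log t
        + 0.13825 * (x₀ + 1) ^ 2 * (1 / t ^ 2) - 0.0497
        + 1 / (2 * x₀ + 1) + 0.4473 / (2 * x₁ + 1)
        - (0.5527 * x₀ - 0.1387) * 4 / (1 + 4 * x₀ ^ 2) * (1 / t ^ 2) := by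
  obtain ⟨hk1, hk2⟩ := kappa_bounds
  have hx0 : 0 < x₀ := by linarith
  have hx1 : 0 < x₁ := by linarith
  have ht0 : 0 < t := by linarith
  have hup := psi_re_le hx0 (t / 2)
  have hlo := mul_le_mul_of_nonneg_left (le_psi_re hx1 (t / 2)) (by linarith : 0 ≤ kappa)
  set A₀ := (x₀ + 1) ^ 2 + (t / 2) ^ 2 with hA₀
  set A₁ := (x₁ + 1) ^ 2 + (t / 2) ^ 2 with hA₁
  set q₀ := x₀ ^ 2 + (t / 2) ^ 2 with hq₀
  set q₁ := x₁ ^ 2 + (t / 2) ^ 2 with hq₁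
  have hA₀p : 0 < A₀ := by positivity
  have hq₀p : 0 < q₀ := by positivity
  have hlogA : kappa * Real.log A₀ ≤ kappa * Real.log A₁ :=
    mul_le_mul_of_nonneg_left (Real.log_le_log hA₀p (by rw [hA₀, hA₁]; gcongr)) (by linarith)
  set s := 1 / t ^ 2 with hs
  have hs0 : 0 < s := by positivity
  have hlogt : Real.log A₀ ≤ 2 * Real.log t + ((x₀ + 1) ^ 2 * s / 2 - 0.18) := by
    have e : A₀ = t ^ 2 * (2 * (((x₀ + 1) ^ 2 * s + 1 / 4) / 2)) := by
      rw [hA₀, hs]; field_simp; ring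
    have hX : 0 < ((x₀ + 1) ^ 2 * s + 1 / 4) / 2 := by positivity
    rw [e, Real.log_mul (by positivity) (by positivity), Real.log_pow,
      Real.log_mul two_ne_zero hX.ne']
    have := Real.log_le_sub_one_of_pos hX
    have := Real.log_two_lt_d9
    push_cast
    linarith
  have hmain : (1 - kappa) / 2 * Real.log A₀
      ≤ (1 - kappa) * Real.log t + 0.13825 * (x₀ + 1) ^ 2 * s - 0.0497 := by
    have hc : 0 ≤ (1 - kappa) / 2 := by linarith
    have h1 := mul_le_mul_of_nonneg_left hlogt hc
    have h2 : (1 - kappa) / 2 * ((x₀ + 1) ^ 2 * s) ≤ 0.2765 * ((x₀ + 1) ^ 2 * s) :=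
      mul_le_mul_of_nonneg_right (by linarith) (by positivity)
    linarith
  have hq : kappa * (x₁ / q₁) ≤ 0.4473 * (x₀ + 0.31) / q₀ := by
    have hq01 : q₀ ≤ q₁ := by rw [hq₀, hq₁]; gcongr
    rw [← mul_div_assoc]
    gcongr
  have hr : (0.5527 * x₀ - 0.1387) * 4 / (1 + 4 * x₀ ^ 2) * s
      ≤ (0.5527 * x₀ - 0.1387) / q₀ := by
    have hc : 0 ≤ 0.5527 * x₀ - 0.1387 := by linarith
    rw [mul_div_assoc, mul_assoc, div_eq_mul_one_div (0.5527 * x₀ - 0.1387) q₀]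
    refine mul_le_mul_of_nonneg_left ?_ hc
    rw [hs, hq₀, div_mul_div_comm, div_le_div_iff₀ (by positivity) (by positivity)]
    nlinarith [mul_nonneg (sq_nonneg x₀) (by nlinarith : (0 : ℝ) ≤ t ^ 2 - 1)]
  have hq' : x₀ / q₀ - 0.4473 * (x₀ + 0.31) / q₀ ≥ (0.5527 * x₀ - 0.1387) / q₀ := by
    rw [ge_iff_le, ← sub_div]
    exact div_le_div_of_nonneg_right (by linarith) hq₀p.le
  have hx1b : kappa * (1 / (2 * x₁ + 1)) ≤ 0.4473 / (2 * x₁ + 1) := by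
    rw [mul_one_div]
    gcongr
  nlinarith

lemma psi_re_sub_kappa_mul_le_of_parity {σ t δ : ℝ} (hσ : 1 < σ) (hσ' : σ ≤ 1.15) (ht : 1 ≤ t)
    (hδ : δ = 0 ∨ δ = 1) :
    (psi (((σ + δ) / 2 : ℝ) + (t / 2 : ℝ) * Complex.I)).re
      - kappa * (psi (((sigma1 σ + δ) / 2 : ℝ) + (t / 2 : ℝ) * Complex.I)).re
      ≤ (1 - kappa) * Real.log t + 0.783 := by
  obtain ⟨hs1, hs2, hs3⟩ := sigma1_bounds hσ
  have hδ0 : 0 ≤ δ := by rcases hδ with h | h <;> simp [h]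
  have h := psi_re_sub_kappa_mul_le (x₀ := (σ + δ) / 2) (x₁ := (sigma1 σ + δ) / 2)
    (by linarith) (by linarith) (by linarith) ht
  refine h.trans ?_
  generalize hx : (σ + δ) / 2 = x₀
  generalize hy : (sigma1 σ + δ) / 2 = x₁
  have hs0 : 0 ≤ 1 / t ^ 2 := by positivity
  have hs1 : 1 / t ^ 2 ≤ 1 := by
    rw [div_le_one (by positivity)]
    nlinarith
  generalize 1 / t ^ 2 = s at hs0 hs1
  rcases hδ with rfl | rfl
  · have b0 : 1 / 2 ≤ x₀ := by linarith
    have b1 : x₀ ≤ 0.575 := by linarith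
    have c1 : 1 / (2 * x₀ + 1) ≤ 0.5 := by
      rw [div_le_iff₀ (by linarith)]; linarith
    have c2 : 0.4473 / (2 * x₁ + 1) ≤ 0.1721 := by
      rw [div_le_iff₀ (by linarith)]; linarith
    have c3 : 0.236 ≤ (0.5527 * x₀ - 0.1387) * 4 / (1 + 4 * x₀ ^ 2) := by
      rw [le_div_iff₀ (by positivity)]; nlinarith
    have c4 : 0.13825 * (x₀ + 1) ^ 2 ≤ 0.3431 := by nlinarith
    have c5 := mul_le_mul_of_nonneg_right c3 hs0
    have c6 := mul_le_mul_of_nonneg_right c4 hs0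
    linarith
  · have b0 : 1 ≤ x₀ := by linarith
    have b1 : x₀ ≤ 1.075 := by linarith
    have c1 : 1 / (2 * x₀ + 1) ≤ 0.3334 := by
      rw [div_le_iff₀ (by linarith)]; linarith
    have c2 : 0.4473 / (2 * x₁ + 1) ≤ 0.1243 := by
      rw [div_le_iff₀ (by linarith)]; linarith
    have c3 : 0.294 ≤ (0.5527 * x₀ - 0.1387) * 4 / (1 + 4 * x₀ ^ 2) := by
      rw [le_div_iff₀ (by positivity)]; nlinarith
    have c4 : 0.13825 * (x₀ + 1) ^ 2 ≤ 0.5953 := by nlinarith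
    have c5 := mul_le_mul_of_nonneg_right c3 hs0
    have c6 := mul_le_mul_of_nonneg_right c4 hs0
    linarith

/-- For `a + b = n ≥ 1`, `1 < σ ≤ 1.15`, `k ∈ {1,2,3,4}`, `γ0 > 1`:
`G(σ+ikγ0) - κ G(σ1+ikγ0) ≤ ( ((1-κ)/2) log γ0 + ((1-κ)/2) log(k/π) + D(k) ) n`. -/
theorem gammaK_term_large_t (a b n : ℕ) (hab : a + b = n) (hn : 1 ≤ n)
    (σ γ0 : ℝ) (hσ : 1 < σ) (hσ' : σ ≤ 1.15)
    (k : ℕ) (hk1 : 1 ≤ k) (hk4 : k ≤ 4) (hγ0 : 1 < γ0) :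
    G a b ((σ : ℂ) + ((k : ℝ) * γ0 : ℝ) * Complex.I)
        - kappa * G a b ((sigma1 σ : ℂ) + ((k : ℝ) * γ0 : ℝ) * Complex.I)
      ≤ ((1 - kappa) / 2 * Real.log γ0 + (1 - kappa) / 2 * Real.log ((k : ℝ) / Real.pi)
          + (if k = 1 then 0.3918 else if k = 2 then 0.3915 else if k = 3 then 0.4062 else (0.4266 : ℝ))) * (n : ℝ) := by
  subst hab
  have hkp : (0 : ℝ) < k := by exact_mod_cast hk1
  have hk1' : (1 : ℝ) ≤ k := by exact_mod_cast hk1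
  have ht : 1 ≤ (k : ℝ) * γ0 := by nlinarith
  have hlog : Real.log ((k : ℝ) * γ0) = Real.log k + Real.log γ0 :=
    Real.log_mul hkp.ne' (by linarith)
  have hD : (0.3915 : ℝ) ≤
      if k = 1 then 0.3918 else if k = 2 then 0.3915 else if k = 3 then 0.4062 else 0.4266 := by
    split_ifs <;> norm_num
  have earg0 : ∀ x t : ℝ, ((x : ℂ) + (t : ℂ) * Complex.I) / 2
      = ((x + 0) / 2 : ℝ) + (t / 2 : ℝ) * Complex.I := by
    intro x t; push_cast; ring
  have earg1 : ∀ x t : ℝ, ((x : ℂ) + (t : ℂ) * Complex.I + 1) / 2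
      = ((x + 1) / 2 : ℝ) + (t / 2 : ℝ) * Complex.I := by
    intro x t; push_cast; ring
  have h0 := psi_re_sub_kappa_mul_le_of_parity hσ hσ' ht (.inl rfl)
  have h1 := psi_re_sub_kappa_mul_le_of_parity hσ hσ' ht (.inr rfl)
  unfold G
  rw [earg0, earg0, earg1, earg1, Real.log_div hkp.ne' Real.pi_ne_zero]
  rw [hlog] at h0 h1
  have ha := mul_le_mul_of_nonneg_left h0 (by positivity : (0 : ℝ) ≤ (a : ℝ) / 2)
  have hb := mul_le_mul_of_nonneg_left h1 (by positivity : (0 : ℝ) ≤ (b : ℝ) / 2)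
  have hDn := mul_le_mul_of_nonneg_right hD (by positivity : (0 : ℝ) ≤ (a : ℝ) + b)
  rw [Nat.cast_add]
  linarith

end ZFR
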